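/- There exist constants c₁ > 0 and c₂ > 0 such that for all real numbers c > 0, d > 0 and t > 0 satisfying (√c + √d)² ≥ t, one has c₁ · (√t/(√c+√d)) · exp(−(√c+√d)²/t) ≤ ∫₀ᵗ s^(−1/2) (t−s)^(−1/2) exp(−c/s) exp(−d/(t−s)) ds ≤ c₂ · (√t/(√c+√d)) · exp(−(√c+√d)²/t). -/

import Mathlib

open MeasureTheory Real

lemma blem_rpow {s : ℝ} (hs : 0 < s) : s ^ (-(1:ℝ)/2) = 1 / √s := by
  rw [Real.sqrt_eq_rpow, neg_div, Real.rpow_neg hs.le, one_div, one_div]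

/-- the phase function -/
noncomputable def blemG (a b t s : ℝ) : ℝ := (b * (√s / √(t-s)) - a * (√(t-s) / √s)) / √t

noncomputable def blemG' (a b t s : ℝ) : ℝ :=
  √t / (2 * √s * √(t-s)) * (b / (t-s) + a / s)

/-- the integrand -/
noncomputable def blemF (c d t s : ℝ) : ℝ :=
  s ^ (-(1:ℝ)/2) * (t - s) ^ (-(1:ℝ)/2) * Real.exp (-c/s) * Real.exp (-d/(t-s))

lemma blem_F_eq {a b t s : ℝ} (hs : 0 < s) (hst : s < t) :
    blemF (a^2) (b^2) t s =
      1 / (√s * √(t-s)) * (Real.exp (-(blemG a b t s)^2) * Real.exp (-(a+b)^2/t)) := by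
  have ht : 0 < t := hs.trans hst
  have hq : 0 < t - s := sub_pos.2 hst
  unfold blemF blemG
  rw [blem_rpow hs, blem_rpow hq, ← Real.exp_add, mul_assoc, ← Real.exp_add]
  have hp' := Real.sqrt_pos.2 hs
  have hq' := Real.sqrt_pos.2 hq
  have ht' := Real.sqrt_pos.2 ht
  have h1 := Real.sq_sqrt hs.le
  have h2 := Real.sq_sqrt hq.le
  have h3 := Real.sq_sqrt ht.le
  have key : -a^2/s + -b^2/(t-s) =
      -((b * (√s / √(t-s)) - a * (√(t-s) / √s)) / √t)^2 + -(a+b)^2/t := by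
    generalize √s = p at *
    generalize √(t-s) = q at *
    generalize √t = r at *
    rw [← h2, ← h1, ← h3]
    have h4 : r^2 = p^2 + q^2 := by rw [h1, h2, h3]; ring
    field_simp
    rw [h4]
    ring
  rw [key]
  ring

lemma blem_hasDeriv {a b t s : ℝ} (hs : 0 < s) (hst : s < t) :
    HasDerivAt (blemG a b t) (blemG' a b t s) s := by
  have ht : 0 < t := hs.trans hst
  have hq : 0 < t - s := sub_pos.2 hst
  have hp' := Real.sqrt_pos.2 hs
  have hq' := Real.sqrt_pos.2 hq
  have ht' := Real.sqrt_pos.2 ht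
  have h1 := Real.sq_sqrt hs.le
  have h2 := Real.sq_sqrt hq.le
  have h3 := Real.sq_sqrt ht.le
  have dp : HasDerivAt (fun x : ℝ => √x) (1 / (2 * √s)) s := Real.hasDerivAt_sqrt hs.ne'
  have dq : HasDerivAt (fun x : ℝ => √(t - x)) (-1 / (2 * √(t-s))) s :=
    ((hasDerivAt_id s).const_sub t).sqrt hq.ne'
  have D := (((dp.div dq hq'.ne').const_mul b).sub ((dq.div dp hp'.ne').const_mul a)).div_const (√t)
  refine HasDerivAt.congr_deriv (f' := _) D ?_
  unfold blemG'
  generalize √s = p at *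
  generalize √(t-s) = q at *
  generalize √t = r at *
  rw [← h2, ← h1]
  have h4 : r^2 = p^2 + q^2 := by rw [h1, h2, h3]; ring
  field_simp
  rw [h4]
  ring

lemma blem_G'_ge {a b t s : ℝ} (ha : 0 < a) (hb : 0 < b) (hs : 0 < s) (hst : s < t) :
    (a + b) / (2 * √t) * (1 / (√s * √(t-s))) ≤ blemG' a b t s := by
  have ht : 0 < t := hs.trans hst
  have hq : 0 < t - s := sub_pos.2 hst
  have hp' := Real.sqrt_pos.2 hs
  have hq' := Real.sqrt_pos.2 hq
  have ht' := Real.sqrt_pos.2 ht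
  have h3 := Real.sq_sqrt ht.le
  have e1 : b / t ≤ b / (t-s) := div_le_div_of_nonneg_left hb.le hq (by linarith)
  have e2 : a / t ≤ a / s := div_le_div_of_nonneg_left ha.le hs hst.le
  calc (a + b) / (2 * √t) * (1 / (√s * √(t-s)))
      = √t / (2 * √s * √(t-s)) * (b / t + a / t) := by
        rw [← h3]
        simp only [Real.sqrt_sq ht'.le]
        field_simp
        rw [h3]
        ring
    _ ≤ _ := by
        unfold blemG'
        gcongr

lemma blem_gauss {a b t : ℝ} (ha : 0 < a) (hb : 0 < b) :
    IntegrableOn (fun s => blemG' a b t s * Real.exp (-(blemG a b t s)^2)) (Set.Ioo 0 t) ∧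
    ∫ s in Set.Ioo 0 t, blemG' a b t s * Real.exp (-(blemG a b t s)^2) ≤ √π := by
  have hpos : ∀ s ∈ Set.Ioo 0 t, 0 < blemG' a b t s := by
    rintro s ⟨hs, hst⟩
    refine lt_of_lt_of_le ?_ (blem_G'_ge ha hb hs hst)
    have ht : 0 < t := hs.trans hst
    have hq : 0 < t - s := sub_pos.2 hst
    positivity
  have hd : ∀ s ∈ Set.Ioo 0 t, HasDerivWithinAt (blemG a b t) (blemG' a b t s) (Set.Ioo 0 t) s :=
    fun s hs => (blem_hasDeriv hs.1 hs.2).hasDerivWithinAt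
  have hm : StrictMonoOn (blemG a b t) (Set.Ioo 0 t) := by
    apply strictMonoOn_of_deriv_pos (convex_Ioo 0 t)
    · exact fun s hs => (hd s hs).continuousWithinAt
    · intro s hs
      rw [interior_Ioo] at hs
      rw [(blem_hasDeriv hs.1 hs.2).deriv]
      exact hpos s hs
  have hgi : Integrable (fun x : ℝ => Real.exp (-x^2)) := by
    simpa using integrable_exp_neg_mul_sq (b := 1) one_pos
  have hg : ∫ x : ℝ, Real.exp (-x^2) = √π := by
    simpa using integral_gaussian 1
  have hcongr : Set.EqOn (fun s => |blemG' a b t s| • Real.exp (-(blemG a b t s)^2))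
      (fun s => blemG' a b t s * Real.exp (-(blemG a b t s)^2)) (Set.Ioo 0 t) := by
    intro s hs
    simp only [smul_eq_mul, abs_of_pos (hpos s hs)]
  constructor
  · have := (integrableOn_image_iff_integrableOn_abs_deriv_smul measurableSet_Ioo hd hm.injOn
      (fun x : ℝ => Real.exp (-x^2))).1 hgi.integrableOn
    exact this.congr_fun hcongr measurableSet_Ioo
  · rw [← setIntegral_congr_fun measurableSet_Ioo hcongr,
      ← integral_image_eq_integral_abs_deriv_smul measurableSet_Ioo hd hm.injOn
      (fun x : ℝ => Real.exp (-x^2)), ← hg]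
    exact setIntegral_le_integral hgi (Filter.Eventually.of_forall fun x => (Real.exp_pos _).le)

lemma blem_le {a b t s : ℝ} (ha : 0 < a) (hb : 0 < b) (hs : 0 < s) (hst : s < t) :
    blemF (a^2) (b^2) t s ≤ (2 * (√t / (a+b)) * Real.exp (-(a+b)^2/t)) *
      (blemG' a b t s * Real.exp (-(blemG a b t s)^2)) := by
  rw [blem_F_eq hs hst]
  have ht' := Real.sqrt_pos.2 (hs.trans hst)
  have h := blem_G'_ge ha hb hs hst
  have h' : 1 / (√s * √(t-s)) ≤ 2 * (√t / (a+b)) * blemG' a b t s := by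
    calc 1 / (√s * √(t-s)) =
        2 * (√t / (a+b)) * ((a + b) / (2 * √t) * (1 / (√s * √(t-s)))) := by
          generalize 1 / (√s * √(t-s)) = x
          field_simp
      _ ≤ _ := by gcongr
  calc _ ≤ (2 * (√t / (a+b)) * blemG' a b t s) *
        (Real.exp (-(blemG a b t s)^2) * Real.exp (-(a+b)^2/t)) := by gcongr
    _ = _ := by ring

lemma blem_nonneg {c d t s : ℝ} (hs : 0 < s) (hst : s < t) : 0 ≤ blemF c d t s := by
  have hq : 0 < t - s := sub_pos.2 hst
  unfold blemF
  positivity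

lemma blem_integrable {a b t : ℝ} (ha : 0 < a) (hb : 0 < b) :
    IntegrableOn (blemF (a^2) (b^2) t) (Set.Ioo 0 t) := by
  refine Integrable.mono' (((blem_gauss (t := t) ha hb).1).const_mul
    (2 * (√t / (a+b)) * Real.exp (-(a+b)^2/t))) ?_ ?_
  · apply Measurable.aestronglyMeasurable
    unfold blemF
    fun_prop
  · refine (ae_restrict_mem measurableSet_Ioo).mono fun s hs => ?_
    rw [Real.norm_of_nonneg (blem_nonneg hs.1 hs.2)]
    exact blem_le ha hb hs.1 hs.2

lemma blem_upper {a b t : ℝ} (ha : 0 < a) (hb : 0 < b) :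
    ∫ s in Set.Ioo 0 t, blemF (a^2) (b^2) t s ≤
      2 * √π * (√t / (a+b)) * Real.exp (-(a+b)^2/t) := by
  obtain ⟨h1, h2⟩ := blem_gauss (t := t) ha hb
  calc _ ≤ ∫ s in Set.Ioo 0 t, (2 * (√t / (a+b)) * Real.exp (-(a+b)^2/t)) *
      (blemG' a b t s * Real.exp (-(blemG a b t s)^2)) :=
        setIntegral_mono_on (blem_integrable ha hb) (h1.const_mul _) measurableSet_Ioo
          fun s hs => blem_le ha hb hs.1 hs.2
    _ = (2 * (√t / (a+b)) * Real.exp (-(a+b)^2/t)) *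
      ∫ s in Set.Ioo 0 t, (blemG' a b t s * Real.exp (-(blemG a b t s)^2)) :=
        integral_const_mul _ _
    _ ≤ (2 * (√t / (a+b)) * Real.exp (-(a+b)^2/t)) * √π := by gcongr
    _ = _ := by ring

/-- pointwise lower bound, with `w = √(t-s)/√s`, `A = a/√t`, `w₀² = b/a`. -/
lemma blem_G_sq {a b t s w₀ : ℝ} (ha : 0 < a) (hs : 0 < s) (hst : s < t)
    (hw₀ : 0 < w₀) (hb : b = a * w₀^2) (h1 : w₀ ≤ √(t-s) / √s)
    (h2 : √(t-s) / √s ≤ w₀ + √t / a) : (blemG a b t s)^2 ≤ 4 := by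
  have ht' := Real.sqrt_pos.2 (hs.trans hst)
  have hp' := Real.sqrt_pos.2 hs
  have hq' := Real.sqrt_pos.2 (sub_pos.2 hst)
  unfold blemG
  rw [← inv_div (√(t-s)) (√s)]
  generalize √(t-s) / √s = w at *
  have hw : 0 < w := hw₀.trans_le h1
  have e : (b * w⁻¹ - a * w) / √t = -(a / √t * (w - w₀) * (1 + w₀ / w)) := by
    rw [hb]; field_simp; ring
  have e1 : a / √t * (w - w₀) ≤ 1 := by
    calc a / √t * (w - w₀) ≤ a / √t * (√t / a) := by gcongr; linarith
      _ = 1 := by field_simp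
  have e0 : 0 ≤ a / √t * (w - w₀) := mul_nonneg (by positivity) (by linarith)
  have e2 : w₀ / w ≤ 1 := by rw [div_le_one hw]; exact h1
  have e3 : 0 ≤ w₀ / w := by positivity
  rw [e]
  generalize a / √t * (w - w₀) = X at *
  generalize w₀ / w = Y at *
  have : X * (1+Y) ≤ 1 * 2 := by gcongr; linarith
  have : 0 ≤ X * (1+Y) := by positivity
  nlinarith

lemma blem_lower_aux {a b t : ℝ} (ha : 0 < a) (hb : 0 < b) (ht : 0 < t) (hba : b ≤ a)
    (hab : √t ≤ a + b) :
    Real.exp (-4) / 20 * (√t / (a+b)) * Real.exp (-(a+b)^2/t) ≤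
    ∫ s in Set.Ioo 0 t, blemF (a^2) (b^2) t s := by
  have ht' := Real.sqrt_pos.2 ht
  set w₀ := √(b/a) with hw₀d
  have hw₀ : 0 < w₀ := Real.sqrt_pos.2 (by positivity)
  have hw₀sq : w₀^2 = b/a := Real.sq_sqrt (by positivity)
  have hbw : b = a * w₀^2 := by rw [hw₀sq]; field_simp
  have hw₀1 : w₀^2 ≤ 1 := by rw [hw₀sq, div_le_one ha]; exact hba
  have hw₀1' : w₀ ≤ 1 := by nlinarith
  set δ := √t / a with hδ
  have hδ0 : 0 < δ := by positivity
  have hδ2 : δ ≤ 2 := by rw [hδ, div_le_iff₀ ha]; linarith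
  set w₁ := w₀ + δ with hw₁
  have hw₁3 : w₁^2 ≤ 9 := by nlinarith
  have hw₁0 : 0 < w₁ := by positivity
  set s₀ := t / (1 + w₀^2) with hs₀
  set s₂ := t / (1 + w₁^2) with hs₂
  have hs₂0 : 0 < s₂ := by positivity
  have hs₀t : s₀ < t := by
    rw [hs₀, div_lt_iff₀ (by positivity)]; nlinarith [mul_pos ht (pow_pos hw₀ 2)]
  have hlen : t * δ * w₁ / 20 ≤ s₀ - s₂ := by
    have : s₀ - s₂ = t * δ * (2 * w₀ + δ) / ((1 + w₀^2) * (1 + w₁^2)) := by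
      rw [hs₀, hs₂, hw₁]; field_simp; ring
    rw [this]
    have : (1 + w₀^2) * (1 + w₁^2) ≤ 2 * 10 := by gcongr <;> linarith
    apply div_le_div₀ <;> first | positivity | linarith | skip
    gcongr; linarith
  have hle : s₂ ≤ s₀ := by
    have : 0 ≤ t * δ * w₁ / 20 := by positivity
    linarith
  have hsub : Set.Icc s₂ s₀ ⊆ Set.Ioo 0 t := fun s hs =>
    ⟨hs₂0.trans_le hs.1, hs.2.trans_lt hs₀t⟩
  have hpt : ∀ s ∈ Set.Icc s₂ s₀,
      1 / (t * w₁) * (Real.exp (-4) * Real.exp (-(a+b)^2/t)) ≤ blemF (a^2) (b^2) t s := by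
    intro s hs
    obtain ⟨hs0, hst⟩ := hsub hs
    have hp' := Real.sqrt_pos.2 hs0
    have hq' := Real.sqrt_pos.2 (sub_pos.2 hst)
    have k1 : w₀ * √s ≤ √(t-s) := by
      apply Real.le_sqrt_of_sq_le
      rw [mul_pow, Real.sq_sqrt hs0.le]
      have := (le_div_iff₀ (by positivity)).1 hs.2
      linarith
    have k2 : √(t-s) ≤ w₁ * √s := by
      rw [Real.sqrt_le_left (by positivity), mul_pow, Real.sq_sqrt hs0.le]
      have := (div_le_iff₀ (by positivity)).1 hs.1
      linarith
    have hG := blem_G_sq (b := b) ha hs0 hst hw₀ hbw ((le_div_iff₀ hp').2 k1)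
      ((div_le_iff₀ hp').2 k2)
    rw [blem_F_eq hs0 hst]
    have k3 : √s * √(t-s) ≤ t * w₁ := by
      calc √s * √(t-s) ≤ √s * (w₁ * √s) := by gcongr
        _ = (√s)^2 * w₁ := by ring
        _ = s * w₁ := by rw [Real.sq_sqrt hs0.le]
        _ ≤ t * w₁ := by gcongr
    gcongr
  have hint := blem_integrable (t := t) ha hb
  calc Real.exp (-4) / 20 * (√t / (a+b)) * Real.exp (-(a+b)^2/t)
      ≤ Real.exp (-4) / 20 * δ * Real.exp (-(a+b)^2/t) := by
        rw [hδ]; gcongr; linarith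
    _ = (t * δ * w₁ / 20) * (1 / (t * w₁) * (Real.exp (-4) * Real.exp (-(a+b)^2/t))) := by
        generalize Real.exp (-(a+b)^2/t) = E
        field_simp
    _ ≤ (s₀ - s₂) * (1 / (t * w₁) * (Real.exp (-4) * Real.exp (-(a+b)^2/t))) := by gcongr
    _ = ∫ s in Set.Icc s₂ s₀, 1 / (t * w₁) * (Real.exp (-4) * Real.exp (-(a+b)^2/t)) := by
        rw [setIntegral_const, smul_eq_mul, Real.volume_real_Icc_of_le hle]
    _ ≤ ∫ s in Set.Icc s₂ s₀, blemF (a^2) (b^2) t s :=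
        setIntegral_mono_on (integrableOn_const (by simp)) (hint.mono_set hsub)
          measurableSet_Icc hpt
    _ ≤ _ := setIntegral_mono_set hint
        ((ae_restrict_mem measurableSet_Ioo).mono fun s hs => blem_nonneg hs.1 hs.2)
        hsub.eventuallyLE

lemma blem_symm {c d t : ℝ} (ht : 0 < t) :
    ∫ s in Set.Ioo 0 t, blemF c d t s = ∫ s in Set.Ioo 0 t, blemF d c t s := by
  rw [← integral_Ioc_eq_integral_Ioo, ← integral_Ioc_eq_integral_Ioo,
    ← intervalIntegral.integral_of_le ht.le, ← intervalIntegral.integral_of_le ht.le]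
  have h := intervalIntegral.integral_comp_sub_left (a := 0) (b := t) (fun s => blemF d c t s) t
  simp only [sub_self, sub_zero] at h
  rw [← h]
  congr 1
  ext s
  unfold blemF
  rw [sub_sub_cancel]
  ring

lemma blem_lower {a b t : ℝ} (ha : 0 < a) (hb : 0 < b) (ht : 0 < t) (hab : √t ≤ a + b) :
    Real.exp (-4) / 20 * (√t / (a+b)) * Real.exp (-(a+b)^2/t) ≤
    ∫ s in Set.Ioo 0 t, blemF (a^2) (b^2) t s := by
  rcases le_total b a with h | h
  · exact blem_lower_aux ha hb ht h hab
  · rw [blem_symm ht, add_comm a b]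
    exact blem_lower_aux hb ha ht h (by linarith)

theorem bessel_lemma2_estimate :
    ∃ c₁ c₂ : ℝ, 0 < c₁ ∧ 0 < c₂ ∧
      ∀ c d t : ℝ, 0 < c → 0 < d → 0 < t → t ≤ (Real.sqrt c + Real.sqrt d)^2 →
        c₁ * (Real.sqrt t / (Real.sqrt c + Real.sqrt d)) *
            Real.exp (-(Real.sqrt c + Real.sqrt d)^2 / t)
          ≤ (∫ s in Set.Ioo (0:ℝ) t,
              s ^ (-(1:ℝ)/2) * (t - s) ^ (-(1:ℝ)/2) * Real.exp (-c/s) * Real.exp (-d/(t-s))) ∧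
        (∫ s in Set.Ioo (0:ℝ) t,
              s ^ (-(1:ℝ)/2) * (t - s) ^ (-(1:ℝ)/2) * Real.exp (-c/s) * Real.exp (-d/(t-s)))
          ≤ c₂ * (Real.sqrt t / (Real.sqrt c + Real.sqrt d)) *
              Real.exp (-(Real.sqrt c + Real.sqrt d)^2 / t) := by
  refine ⟨Real.exp (-4) / 20, 2 * √π, by positivity, by positivity, ?_⟩
  intro c d t hc hd ht h
  have hc' := Real.sqrt_pos.2 hc
  have hd' := Real.sqrt_pos.2 hd
  have hl := blem_lower hc' hd' ht ((Real.sqrt_le_left (by positivity)).2 h)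
  have hu := blem_upper (t := t) hc' hd'
  rw [Real.sq_sqrt hc.le, Real.sq_sqrt hd.le] at hl hu
  exact ⟨hl, hu⟩
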